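/- Fix an integer z ≥ 1, define ζ(l) = C(z+l, z) for integers l ≥ 0 and ζ(-1) = 0, and let β_nc(φ) = Σ_{l=0}^∞ (z+l) · (φ^{ζ(l-1)} − φ^{ζ(l)}). Then β_nc is non-decreasing on [0,1): for all reals φ₁, φ₂ with 0 ≤ φ₁ ≤ φ₂ < 1, β_nc(φ₁) ≤ β_nc(φ₂). -/

import Mathlib

/-- `zetaPrev z l = ζ(l-1)` where `ζ(l) = C(z+l, z)` for `l ≥ 0` and `ζ(-1) = 0`. -/
def zetaPrev (z : ℕ) : ℕ → ℕ
  | 0 => 0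
  | l + 1 => (z + l).choose z

/-- `β_nc(φ) = Σ_{l=0}^∞ (z+l) · (φ^{ζ(l-1)} − φ^{ζ(l)})`. -/
noncomputable def betaNC (z : ℕ) (φ : ℝ) : ℝ :=
  ∑' l : ℕ, ((z : ℝ) + l) * (φ ^ zetaPrev z l - φ ^ (z + l).choose z)

open Filter Topology

lemma succ_le_choose_add {z : ℕ} (hz : 1 ≤ z) (l : ℕ) : l + 1 ≤ (z + l).choose z := by
  have h : (1 + l).choose l ≤ (z + l).choose l := Nat.choose_le_choose l (by omega)
  rw [Nat.choose_symm_add]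
  rwa [← Nat.choose_symm_add, Nat.choose_one_right, add_comm] at h

lemma le_zetaPrev {z : ℕ} (hz : 1 ≤ z) : ∀ l, l ≤ zetaPrev z l
  | 0 => le_rfl
  | l + 1 => succ_le_choose_add hz l

lemma zetaPrev_le_choose (z : ℕ) : ∀ l, zetaPrev z l ≤ (z + l).choose z
  | 0 => Nat.zero_le _
  | l + 1 => Nat.choose_le_choose z (by omega)

/-- Summation by parts for the partial sums of `betaNC`. -/
lemma sum_range_betaNC (z : ℕ) (φ : ℝ) (n : ℕ) :
    ∑ l ∈ Finset.range n, ((z : ℝ) + l) * (φ ^ zetaPrev z l - φ ^ (z + l).choose z) =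
      z + ∑ l ∈ Finset.range n, φ ^ (z + l).choose z - (z + n) * φ ^ zetaPrev z n := by
  induction n with
  | zero => simp [zetaPrev]
  | succ n ih =>
    rw [Finset.sum_range_succ, Finset.sum_range_succ, ih]
    simp only [zetaPrev]
    push_cast
    ring

lemma summable_pow_choose {z : ℕ} (hz : 1 ≤ z) {φ : ℝ} (h0 : 0 ≤ φ) (h1 : φ < 1) :
    Summable fun l : ℕ => φ ^ (z + l).choose z :=
  (summable_geometric_of_lt_one h0 h1).of_nonneg_of_le (fun _ => pow_nonneg h0 _) fun l =>
    pow_le_pow_of_le_one h0 h1.le ((Nat.le_succ l).trans (succ_le_choose_add hz l))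

lemma tendsto_mul_pow_zetaPrev {z : ℕ} (hz : 1 ≤ z) {φ : ℝ} (h0 : 0 ≤ φ) (h1 : φ < 1) :
    Tendsto (fun n : ℕ => ((z : ℝ) + n) * φ ^ zetaPrev z n) atTop (𝓝 0) := by
  have h : Tendsto (fun n : ℕ => ((z : ℝ) + n) * φ ^ n) atTop (𝓝 0) := by
    simpa [add_mul] using ((tendsto_pow_atTop_nhds_zero_of_lt_one h0 h1).const_mul (z : ℝ)).add
      (tendsto_self_mul_const_pow_of_lt_one h0 h1)
  refine squeeze_zero (fun n => by positivity) (fun n => ?_) h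
  exact mul_le_mul_of_nonneg_left (pow_le_pow_of_le_one h0 h1.le (le_zetaPrev hz n))
    (by positivity)

lemma betaNC_eq_add_tsum {z : ℕ} (hz : 1 ≤ z) {φ : ℝ} (h0 : 0 ≤ φ) (h1 : φ < 1) :
    betaNC z φ = z + ∑' l : ℕ, φ ^ (z + l).choose z := by
  refine HasSum.tsum_eq ((hasSum_iff_tendsto_nat_of_nonneg (fun l => ?_) _).2 ?_)
  · exact mul_nonneg (by positivity)
      (sub_nonneg.2 (pow_le_pow_of_le_one h0 h1.le (zetaPrev_le_choose z l)))
  · simp only [sum_range_betaNC]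
    simpa using ((summable_pow_choose hz h0 h1).hasSum.tendsto_sum_nat.const_add (z : ℝ)).sub
      (tendsto_mul_pow_zetaPrev hz h0 h1)

/-- `β_nc` is non-decreasing on `[0,1)`: for all reals `φ₁, φ₂` with
`0 ≤ φ₁ ≤ φ₂ < 1`, `β_nc(φ₁) ≤ β_nc(φ₂)`. -/
theorem betaNC_monotone (z : ℕ) (hz : 1 ≤ z) (φ₁ φ₂ : ℝ)
    (h0 : 0 ≤ φ₁) (h12 : φ₁ ≤ φ₂) (h1 : φ₂ < 1) :
    betaNC z φ₁ ≤ betaNC z φ₂ := by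
  have h2 : 0 ≤ φ₂ := h0.trans h12
  have h3 : φ₁ < 1 := h12.trans_lt h1
  rw [betaNC_eq_add_tsum hz h0 h3, betaNC_eq_add_tsum hz h2 h1]
  gcongr with l
  · exact summable_pow_choose hz h0 h3
  · exact summable_pow_choose hz h2 h1
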